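/- Let q be a power of 2 and G = SL(2, F_q). Then the sum of the degrees of the irreducible complex characters of G equals q². Consequently, for every faithful finite-dimensional complex representation V of G one has Z_V(G) = {1} and, for all n ≥ 0, (1/|G|) · Σ_{g ∈ Z_V(G)} S(g) · ω_V(g)^n = q/(q²−1). -/

import Mathlib

open CategoryTheory Finset Matrix

/-- The column sum `S(g) = χ₁(g) + ⋯ + χ_N(g)` of a family of characters. -/
noncomputable def colSum {G : Type} [Group G] [Fintype G] {N : ℕ}
    (χ : Fin N → FDRep ℂ G) (g : G) : ℂ :=
  ∑ t, (χ t).character g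

theorem LinearMap.trace_eq_trace_restrict_add_of_isCompl {K V : Type*} [Field K] [AddCommGroup V]
    [Module K V] [FiniteDimensional K V] {p q : Submodule K V} (h : IsCompl p q)
    {f : V →ₗ[K] V} (hp : ∀ x ∈ p, f x ∈ p) (hq : ∀ x ∈ q, f x ∈ q) :
    LinearMap.trace K V f =
      LinearMap.trace K p (f.restrict hp) + LinearMap.trace K q (f.restrict hq) := by
  rw [← LinearMap.trace_prodMap', ← LinearMap.trace_conj' _ (Submodule.prodEquivOfIsCompl p q h)]
  congr 1
  ext x
  obtain ⟨y, rfl⟩ := (Submodule.prodEquivOfIsCompl p q h).surjective x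
  simp [LinearEquiv.conj_apply]

/-- The right regular representation of `G` on functions `G → K`. -/
def Representation.rightRegularFun (K G : Type*) [Field K] [Group G] :
    Representation K G (G → K) where
  toFun g := LinearMap.funLeft K K (· * g)
  map_one' := by ext; simp [LinearMap.funLeft]
  map_mul' g h := by ext f x; simp [LinearMap.funLeft, mul_assoc]

theorem Representation.character_rightRegularFun (K G : Type*) [Field K] [Group G] [Fintype G]
    [DecidableEq G] (g : G) :
    (Representation.rightRegularFun K G).character g =
      if g = 1 then (Fintype.card G : K) else 0 := by
  rw [Representation.character, LinearMap.trace_eq_matrix_trace K (Pi.basisFun K G)]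
  simp [Matrix.trace, Representation.rightRegularFun, LinearMap.funLeft,
    Pi.single_apply]

namespace FDRep

variable {G : Type} [Group G]

theorem simple_of_isIrreducible [Fintype G] {V : Type} [AddCommGroup V] [Module ℂ V]
    [FiniteDimensional ℂ V] (ρ : Representation ℂ G V) [Representation.IsIrreducible ρ] : Simple (FDRep.of ρ) := by
  have : Invertible (Nat.card G : ℂ) := invertibleOfNonzero (NeZero.ne _)
  rw [simple_iff_char_is_norm_one]
  have h := Representation.char_orthonormal ρ ρ
  rw [if_pos ⟨Representation.Equiv.refl ρ⟩, inv_mul_eq_one₀ (NeZero.ne _)] at h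
  exact h.symm

theorem eq_top_of_simple (V : FDRep ℂ G) [Simple V] (p : Submodule ℂ V)
    (hp : ∀ g, ∀ x ∈ p, V.ρ g x ∈ p) (hne : p ≠ ⊥) : p = ⊤ := by
  let σ : Subrepresentation V.ρ := ⟨p, fun g x hx => hp g x hx⟩
  let ι : FDRep.of σ.toRepresentation ⟶ V :=
    ⟨FGModuleCat.ofHom p.subtype, fun g => by ext x; rfl⟩
  have : Mono ι := ConcreteCategory.mono_of_injective ι p.subtype_injective
  have hι : ι ≠ 0 := by
    intro h
    refine hne (Submodule.eq_bot_iff _ |>.2 fun x hx => ?_)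
    exact congrArg (fun f : FDRep.of σ.toRepresentation ⟶ V => f.hom.hom.hom ⟨x, hx⟩) h
  have := isIso_of_mono_of_nonzero hι
  exact Submodule.eq_top_of_finrank_eq (isoToLinearEquiv (asIso ι)).finrank_eq

theorem exists_character_eq_sum [Fintype G] {N : ℕ} (χ : Fin N → FDRep ℂ G)
    (hcomplete : ∀ W : FDRep ℂ G, Simple W → ∃ t, Nonempty (W ≅ χ t))
    {V : Type} [AddCommGroup V] [Module ℂ V] [FiniteDimensional ℂ V]
    (ρ : Representation ℂ G V) :
    ∃ n : Fin N → ℂ, ∀ g, ρ.character g = ∑ t, n t * (χ t).character g := by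
  induction hd : Module.finrank ℂ V using Nat.strong_induction_on generalizing V with
  | _ d ih =>
  subst hd
  rcases subsingleton_or_nontrivial V with hV | hV
  · exact ⟨0, fun g => by simp [Representation.character, Subsingleton.elim (ρ g) 0]⟩
  by_cases hirr : ρ.IsIrreducible
  · obtain ⟨t, ⟨e⟩⟩ := hcomplete _ (simple_of_isIrreducible ρ)
    refine ⟨Pi.single t 1, fun g => ?_⟩
    have h : ρ.character g = (χ t).character g := congrFun (char_iso e) g
    simp [h, Pi.single_apply]
  have : Nontrivial (Subrepresentation ρ) :=
    ⟨⊥, ⊤, fun h => (bot_ne_top (α := Submodule ℂ V)) (congrArg Subrepresentation.toSubmodule h)⟩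
  obtain ⟨p, hp0, hp1⟩ : ∃ p : Subrepresentation ρ, p ≠ ⊥ ∧ p ≠ ⊤ := by
    by_contra! h
    exact hirr ⟨fun p => or_iff_not_imp_left.2 (h p)⟩
  obtain ⟨q, hpq⟩ := exists_isCompl p
  have hc : IsCompl p.toSubmodule q.toSubmodule :=
    IsCompl.of_eq (congrArg Subrepresentation.toSubmodule hpq.inf_eq_bot)
      (congrArg Subrepresentation.toSubmodule hpq.sup_eq_top)
  have hq1 : q ≠ ⊤ := fun h => hp0 (by simpa [h] using hpq.inf_eq_bot)
  have hlt (r : Subrepresentation ρ) (hr : r ≠ ⊤) :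
      Module.finrank ℂ r.toSubmodule < Module.finrank ℂ V :=
    Submodule.finrank_lt fun h => hr (Subrepresentation.toSubmodule_injective h)
  obtain ⟨m, hm⟩ := ih _ (hlt p hp1) p.toRepresentation rfl
  obtain ⟨n, hn⟩ := ih _ (hlt q hq1) q.toRepresentation rfl
  refine ⟨m + n, fun g => ?_⟩
  simp only [Pi.add_apply, add_mul, Finset.sum_add_distrib, ← hm, ← hn]
  exact LinearMap.trace_eq_trace_restrict_add_of_isCompl hc (p.apply_mem_toSubmodule g)
    (q.apply_mem_toSubmodule g)

/-- Second orthogonality relation, at the column of the identity. -/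
theorem sum_finrank_mul_character [Fintype G] [DecidableEq G] {N : ℕ} (χ : Fin N → FDRep ℂ G)
    (hsimple : ∀ t, Simple (χ t))
    (hdistinct : ∀ s t : Fin N, Nonempty (χ s ≅ χ t) → s = t)
    (hcomplete : ∀ W : FDRep ℂ G, Simple W → ∃ t, Nonempty (W ≅ χ t)) (g : G) :
    ∑ t, (χ t).character 1 * (χ t).character g = if g = 1 then (Fintype.card G : ℂ) else 0 := by
  have : Invertible (Nat.card G : ℂ) := invertibleOfNonzero (NeZero.ne _)
  obtain ⟨n, hn⟩ := exists_character_eq_sum χ hcomplete (Representation.rightRegularFun ℂ G)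
  have horth (s t : Fin N) : (Nat.card G : ℂ)⁻¹ * ∑ g, (χ s).character g * (χ t).character g⁻¹ =
      if s = t then 1 else 0 := by
    rw [char_orthonormal]
    congr 1
    exact propext ⟨hdistinct s t, fun h => h ▸ ⟨Iso.refl _⟩⟩
  have hn1 (t : Fin N) : (χ t).character 1 = n t := by
    have h : (Nat.card G : ℂ)⁻¹ * ∑ g, (Representation.rightRegularFun ℂ G).character g *
        (χ t).character g⁻¹ = n t := by
      simp_rw [hn, Finset.sum_mul, mul_assoc]
      rw [Finset.sum_comm, Finset.mul_sum]
      refine (Finset.sum_congr rfl fun s _ => ?_).trans (Fintype.sum_ite_eq' t n)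
      rw [← Finset.mul_sum, mul_left_comm, horth, mul_ite, mul_one, mul_zero]
    rw [← h]
    simp [Representation.character_rightRegularFun]
  simp_rw [hn1, ← hn, Representation.character_rightRegularFun]

end FDRep

namespace Matrix.SpecialLinearGroup

variable {F : Type*} [Field F]

/-- The upper unitriangular matrix with upper right entry `x`. -/
def upper (x : F) : SpecialLinearGroup (Fin 2) F := ⟨!![1, x; 0, 1], by simp⟩

/-- The lower unitriangular matrix with lower left entry `x`. -/
def lower (x : F) : SpecialLinearGroup (Fin 2) F := ⟨!![1, 0; x, 1], by simp⟩

/-- The diagonal matrix with entries `a` and `a⁻¹`. -/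
def diag (a : Fˣ) : SpecialLinearGroup (Fin 2) F := ⟨!![(a : F), 0; 0, (a⁻¹ : Fˣ)], by simp⟩

/-- The antidiagonal matrix with lower left entry `c`. -/
def antidiag (c : Fˣ) : SpecialLinearGroup (Fin 2) F :=
  ⟨!![0, -(c⁻¹ : Fˣ); (c : F), 0], by simp⟩

/-- The reflection of a matrix in its antidiagonal. -/
def antitranspose (g : SpecialLinearGroup (Fin 2) F) : SpecialLinearGroup (Fin 2) F :=
  ⟨!![g 1 1, g 0 1; g 1 0, g 0 0], by
    rw [det_fin_two_of]
    linear_combination (det_fin_two g.1).symm.trans g.2⟩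

theorem coe_upper (x : F) : (upper x : Matrix (Fin 2) (Fin 2) F) = !![1, x; 0, 1] := rfl

theorem coe_lower (x : F) : (lower x : Matrix (Fin 2) (Fin 2) F) = !![1, 0; x, 1] := rfl

theorem coe_diag (a : Fˣ) :
    (diag a : Matrix (Fin 2) (Fin 2) F) = !![(a : F), 0; 0, (a : F)⁻¹] := by
  simp [diag]

theorem coe_antidiag (c : Fˣ) :
    (antidiag c : Matrix (Fin 2) (Fin 2) F) = !![0, -(c : F)⁻¹; (c : F), 0] := by
  simp [antidiag]

theorem coe_antitranspose (g : SpecialLinearGroup (Fin 2) F) :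
    (antitranspose g : Matrix (Fin 2) (Fin 2) F) = !![g 1 1, g 0 1; g 1 0, g 0 0] := rfl

theorem upper_zero : upper (0 : F) = 1 := by
  ext i j; fin_cases i <;> fin_cases j <;> simp [coe_upper]

theorem upper_add (x y : F) : upper (x + y) = upper x * upper y := by
  ext i j; fin_cases i <;> fin_cases j <;> simp [coe_upper, add_comm]

theorem diag_mul_upper (a : Fˣ) (x : F) : diag a * upper x = upper (a ^ 2 * x) * diag a := by
  ext i j; fin_cases i <;> fin_cases j <;> simp [coe_upper, coe_diag]
  field_simp

theorem antitranspose_mul (g h : SpecialLinearGroup (Fin 2) F) :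
    antitranspose (g * h) = antitranspose h * antitranspose g := by
  ext i j
  fin_cases i <;> fin_cases j <;>
    simp [coe_antitranspose, mul_apply, Fin.sum_univ_two] <;> ring

theorem antitranspose_upper (x : F) : antitranspose (upper x) = upper x := by
  ext i j; fin_cases i <;> fin_cases j <;> simp [coe_antitranspose, coe_upper]

theorem antitranspose_antidiag (c : Fˣ) : antitranspose (antidiag c) = antidiag c := by
  ext i j; fin_cases i <;> fin_cases j <;> simp [coe_antitranspose, coe_antidiag]

theorem antitranspose_diag (a : Fˣ) : antitranspose (diag a) = diag a⁻¹ := by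
  ext i j; fin_cases i <;> fin_cases j <;> simp [coe_antitranspose, coe_diag]

theorem exists_eq_upper_mul_antidiag_mul_upper {g : SpecialLinearGroup (Fin 2) F}
    (hg : g 1 0 ≠ 0) : ∃ (x y : F) (c : Fˣ), g = upper x * antidiag c * upper y := by
  refine ⟨g 0 0 / g 1 0, g 1 1 / g 1 0, Units.mk0 _ hg, ?_⟩
  have h := g.det_coe
  rw [det_fin_two] at h
  ext i j
  fin_cases i <;> fin_cases j <;> simp [coe_upper, coe_antidiag] <;> field_simp
  linear_combination -h

theorem exists_eq_diag_mul_upper {g : SpecialLinearGroup (Fin 2) F} (hg : g 1 0 = 0) :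
    ∃ (a : Fˣ) (x : F), g = diag a * upper x := by
  have h := g.det_coe
  rw [det_fin_two, hg, mul_zero, sub_zero] at h
  have h0 := left_ne_zero_of_mul_eq_one h
  refine ⟨Units.mk0 _ h0, g 0 1 / g 0 0, ?_⟩
  ext i j; fin_cases i <;> fin_cases j <;> simp [coe_upper, coe_diag, hg]
  · field_simp
  · exact eq_inv_of_mul_eq_one_right h

theorem eq_top_of_upper_mem {H : Subgroup (SpecialLinearGroup (Fin 2) F)} [H.Normal]
    (hH : ∀ x, upper x ∈ H) : H = ⊤ := by
  have hL (x : F) : lower x ∈ H := by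
    have : lower x = antidiag 1 * upper (-x) * (antidiag 1)⁻¹ := by
      rw [eq_mul_inv_iff_mul_eq]
      ext i j; fin_cases i <;> fin_cases j <;> simp [coe_upper, coe_lower, coe_antidiag]
    rw [this]
    exact Subgroup.Normal.conj_mem ‹_› _ (hH _) _
  have hne (g : SpecialLinearGroup (Fin 2) F) (hg : g 1 0 ≠ 0) : g ∈ H := by
    have : g = upper ((g 0 0 - 1) / g 1 0) * lower (g 1 0) * upper ((g 1 1 - 1) / g 1 0) := by
      have h := g.det_coe
      rw [det_fin_two] at h
      ext i j
      fin_cases i <;> fin_cases j <;> simp [coe_upper, coe_lower] <;> field_simp <;> ring_nf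
      linear_combination -h
    rw [this]
    exact H.mul_mem (H.mul_mem (hH _) (hL _)) (hH _)
  refine (Subgroup.eq_top_iff' H).2 fun g => ?_
  by_cases hg : g 1 0 = 0
  · rw [← H.mul_mem_cancel_right (hL 1)]
    refine hne _ ?_
    have h := g.det_coe
    rw [det_fin_two, hg, mul_zero, sub_zero] at h
    simpa [coe_lower, mul_apply, Fin.sum_univ_two, hg] using right_ne_zero_of_mul_eq_one h
  · exact hne g hg

theorem card_fin_two [Fintype F] [DecidableEq F] :
    Fintype.card (SpecialLinearGroup (Fin 2) F) = Fintype.card F * (Fintype.card F ^ 2 - 1) := by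
  have hq := Fintype.one_lt_card (α := F)
  let f : GL (Fin 2) F →* Fˣ := GeneralLinearGroup.det
  have hf : Function.Surjective f := fun a => by
    refine ⟨GeneralLinearGroup.mkOfDetNeZero !![(a : F), 0; 0, 1] (by simp), ?_⟩
    ext; simp [f, GeneralLinearGroup.mkOfDetNeZero]
  have hk : Nat.card f.ker = Fintype.card (SpecialLinearGroup (Fin 2) F) := by
    have hr : f.ker = (toGL (n := Fin 2) (R := F)).range := by
      ext g
      refine ⟨fun hg => ⟨⟨g.1, congrArg Units.val hg⟩, Units.ext rfl⟩, ?_⟩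
      rintro ⟨h, rfl⟩
      exact Units.ext h.2
    rw [hr, Nat.card_congr (MonoidHom.ofInjective toGL_injective).toEquiv.symm,
      Nat.card_eq_fintype_card]
  have h := f.ker.card_mul_index
  rw [hk, Subgroup.index_ker, MonoidHom.range_eq_top.2 hf, card_GL_field, Fin.prod_univ_two,
    Nat.card_congr Subgroup.topEquiv.toEquiv, Nat.card_eq_fintype_card, Fintype.card_units] at h
  refine Nat.eq_of_mul_eq_mul_right (Nat.sub_pos_of_lt hq) (h.trans ?_)
  simp only [Fin.val_zero, Fin.val_one, pow_zero, pow_one, sq, ← Nat.mul_sub_one]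
  ring

end Matrix.SpecialLinearGroup

namespace Representation

open Matrix.SpecialLinearGroup

variable {F V : Type*} [Field F] [Fintype F] [AddCommGroup V] [Module ℂ V]
  (ρ : Representation ℂ (SpecialLinearGroup (Fin 2) F) V) (ψ : AddChar F ℂ)

/-- The projection onto the space of vectors on which the upper unitriangular subgroup acts
through the additive character `ψ`. -/
noncomputable def whittaker : Module.End ℂ V :=
  (Fintype.card F : ℂ)⁻¹ • ∑ x, ψ (-x) • ρ (upper x)

theorem upper_mul_whittaker (y : F) : ρ (upper y) * whittaker ρ ψ = ψ y • whittaker ρ ψ := by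
  simp only [whittaker, mul_smul_comm, Finset.mul_sum, smul_comm (ψ y)]
  congr 1
  rw [Finset.smul_sum, ← Equiv.sum_comp (Equiv.addLeft y) fun x => ψ y • ψ (-x) • ρ (upper x)]
  refine Finset.sum_congr rfl fun x _ => ?_
  rw [← map_mul, ← upper_add, smul_smul, ← AddChar.map_add_eq_mul, Equiv.coe_addLeft]
  congr 2
  ring

theorem whittaker_mul_upper (y : F) : whittaker ρ ψ * ρ (upper y) = ψ y • whittaker ρ ψ := by
  rw [← upper_mul_whittaker]
  simp only [whittaker, mul_smul_comm, smul_mul_assoc, Finset.mul_sum, Finset.sum_mul, ← map_mul,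
    ← upper_add, add_comm]

theorem whittaker_mul_self : whittaker ρ ψ * whittaker ρ ψ = whittaker ρ ψ := by
  nth_rw 1 [whittaker]
  simp_rw [smul_mul_assoc, Finset.sum_mul, smul_mul_assoc, upper_mul_whittaker, smul_smul,
    ← AddChar.map_add_eq_mul]
  simp [← Nat.cast_smul_eq_nsmul ℂ, smul_smul]

theorem whittaker_mul_mul_whittaker (g h : SpecialLinearGroup (Fin 2) F) :
    whittaker ρ ψ * ρ g * whittaker ρ ψ * ρ h * whittaker ρ ψ =
      (Fintype.card F : ℂ)⁻¹ • ∑ x, ψ (-x) •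
        (whittaker ρ ψ * ρ (g * upper x * h) * whittaker ρ ψ) := by
  nth_rw 2 [whittaker]
  simp only [mul_smul_comm, smul_mul_assoc, Finset.mul_sum, Finset.sum_mul, map_mul, mul_assoc]

theorem whittaker_diag_whittaker [CharP F 2] (hψ : ψ ≠ 1) {a : Fˣ} (ha : a ≠ 1) :
    whittaker ρ ψ * ρ (diag a) * whittaker ρ ψ = 0 := by
  have hc : (a : F) ^ 2 - 1 ≠ 0 := by
    have h : (a : F) ^ 2 - 1 = (a - 1) ^ 2 := by
      rw [sub_pow_char, one_pow]
    rw [h]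
    exact pow_ne_zero _ (sub_ne_zero.2 fun h => ha (Units.ext h))
  obtain ⟨y, hy⟩ := AddChar.ne_one_iff.1 hψ
  obtain ⟨x, rfl⟩ : ∃ x, ((a : F) ^ 2 - 1) * x = y := ⟨y / ((a : F) ^ 2 - 1), by field_simp⟩
  have h : ψ x • (whittaker ρ ψ * ρ (diag a) * whittaker ρ ψ) =
      ψ (a ^ 2 * x) • (whittaker ρ ψ * ρ (diag a) * whittaker ρ ψ) := by
    rw [← mul_smul_comm, ← upper_mul_whittaker, ← smul_mul_assoc, ← smul_mul_assoc,
      ← whittaker_mul_upper]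
    simp only [mul_assoc]
    rw [← mul_assoc (ρ (diag a)), ← mul_assoc (ρ (upper _)), ← map_mul, ← map_mul, diag_mul_upper]
  by_contra h0
  have h1 := smul_left_injective ℂ h0 h
  refine hy ?_
  have h2 : ψ (((a : F) ^ 2 - 1) * x) * ψ x = ψ x := by
    rw [← AddChar.map_add_eq_mul, h1]; congr 1; ring
  exact mul_eq_right₀ (ψ.val_isUnit x |>.ne_zero) |>.1 h2

theorem whittaker_antitranspose [CharP F 2] (hψ : ψ ≠ 1) (g : SpecialLinearGroup (Fin 2) F) :
    whittaker ρ ψ * ρ (antitranspose g) * whittaker ρ ψ =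
      whittaker ρ ψ * ρ g * whittaker ρ ψ := by
  have key (x y : F) (n : SpecialLinearGroup (Fin 2) F) :
      whittaker ρ ψ * ρ (upper x * n * upper y) * whittaker ρ ψ =
        (ψ x * ψ y) • (whittaker ρ ψ * ρ n * whittaker ρ ψ) := by
    simp only [map_mul, ← mul_assoc, whittaker_mul_upper]
    rw [mul_assoc _ (ρ (upper y)), upper_mul_whittaker]
    simp only [smul_mul_assoc, mul_smul_comm, smul_smul, mul_comm]
  by_cases hg : g 1 0 = 0
  · obtain ⟨a, x, rfl⟩ := exists_eq_diag_mul_upper hg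
    have h1 := key 0 x (diag a)
    have h2 := key x 0 (diag a⁻¹)
    rw [upper_zero, one_mul] at h1
    rw [upper_zero, mul_one] at h2
    rw [antitranspose_mul, antitranspose_upper, antitranspose_diag, h1, h2]
    by_cases ha : a = 1
    · rw [ha, inv_one, mul_comm]
    · rw [whittaker_diag_whittaker ρ ψ hψ ha,
        whittaker_diag_whittaker ρ ψ hψ (inv_ne_one.2 ha), smul_zero, smul_zero]
  · obtain ⟨x, y, c, rfl⟩ := exists_eq_upper_mul_antidiag_mul_upper hg
    rw [antitranspose_mul, antitranspose_mul, antitranspose_upper, antitranspose_upper,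
      antitranspose_antidiag, ← mul_assoc, key, key, mul_comm (ψ x)]

theorem whittaker_comm [CharP F 2] (hψ : ψ ≠ 1) (g h : SpecialLinearGroup (Fin 2) F) :
    whittaker ρ ψ * ρ g * whittaker ρ ψ * ρ h * whittaker ρ ψ =
      whittaker ρ ψ * ρ h * whittaker ρ ψ * ρ g * whittaker ρ ψ := by
  have split (a b : Module.End ℂ V) : whittaker ρ ψ * a * whittaker ρ ψ * b * whittaker ρ ψ =
      (whittaker ρ ψ * a * whittaker ρ ψ) * (whittaker ρ ψ * b * whittaker ρ ψ) := by
    simp only [mul_assoc]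
    rw [← mul_assoc (whittaker ρ ψ) (whittaker ρ ψ), whittaker_mul_self]
  conv_rhs => rw [split (ρ h), ← whittaker_antitranspose ρ ψ hψ h,
    ← whittaker_antitranspose ρ ψ hψ g, ← split]
  rw [whittaker_mul_mul_whittaker, whittaker_mul_mul_whittaker]
  congr 1
  refine Finset.sum_congr rfl fun x _ => ?_
  rw [← whittaker_antitranspose ρ ψ hψ (g * upper x * h), antitranspose_mul, antitranspose_mul,
    antitranspose_upper, mul_assoc (antitranspose h)]

theorem mem_range_whittaker {v : V} :
    v ∈ LinearMap.range (whittaker ρ ψ) ↔ whittaker ρ ψ v = v :=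
  ⟨fun ⟨w, hw⟩ => hw ▸ LinearMap.congr_fun (whittaker_mul_self ρ ψ) w, fun h => ⟨v, h⟩⟩

/-- Uniqueness of Whittaker models. -/
theorem finrank_range_whittaker [CharP F 2] [FiniteDimensional ℂ V] (hψ : ψ ≠ 1)
    (hρ : ∀ w : V, w ≠ 0 → Submodule.span ℂ (Set.range fun g => ρ g w) = ⊤)
    (h0 : whittaker ρ ψ ≠ 0) : Module.finrank ℂ (LinearMap.range (whittaker ρ ψ)) = 1 := by
  classical
  set W := LinearMap.range (whittaker ρ ψ) with hW
  have hspan (w : V) (hw : w ≠ 0) :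
      Submodule.span ℂ (Set.range fun g => whittaker ρ ψ (ρ g w)) = W := by
    rw [hW, LinearMap.range_eq_map, ← hρ w hw, Submodule.map_span, ← Set.range_comp]
    rfl
  have : Nontrivial W := by
    rw [Submodule.nontrivial_iff_ne_bot]
    exact fun h => h0 (LinearMap.range_eq_bot.1 h)
  have hscalar (g : SpecialLinearGroup (Fin 2) F) :
      ∃ c : ℂ, ∀ w ∈ W, whittaker ρ ψ (ρ g w) = c • w := by
    let T : Module.End ℂ W :=
      (whittaker ρ ψ * ρ g).restrict fun w _ => LinearMap.mem_range_self _ _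
    obtain ⟨c, hc⟩ := Module.End.exists_eigenvalue T
    obtain ⟨v, hv⟩ := hc.exists_hasEigenvector
    have hTv : whittaker ρ ψ (ρ g v) = c • (v : V) := congrArg Subtype.val hv.apply_eq_smul
    have hPv : whittaker ρ ψ (v : V) = v := (mem_range_whittaker ρ ψ).1 v.2
    refine ⟨c, fun w hw => ?_⟩
    rw [← hspan v (by simpa using hv.2)] at hw
    induction hw using Submodule.span_induction with
    | mem x hx =>
      obtain ⟨h, rfl⟩ := hx
      have := LinearMap.congr_fun (whittaker_comm ρ ψ hψ g h) v
      simpa only [Module.End.mul_apply, hPv, hTv, map_smul] using this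
    | zero => simp
    | add x y _ _ hx hy => simp only [map_add, hx, hy, smul_add]
    | smul a x _ hx => rw [map_smul, map_smul, hx, smul_comm]
  obtain ⟨w, hw⟩ := exists_ne (0 : W)
  refine finrank_eq_one w hw fun v => ?_
  have hv : (v : V) ∈ Submodule.span ℂ (Set.range fun g => whittaker ρ ψ (ρ g w)) :=
    (hspan w (by simpa using hw)).symm ▸ v.2
  rw [Submodule.mem_span_range_iff_exists_fun] at hv
  obtain ⟨a, ha⟩ := hv
  choose c hc using hscalar
  refine ⟨∑ g, a g * c g, Subtype.ext ?_⟩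
  rw [← ha, Submodule.coe_smul, Finset.sum_smul]
  exact Finset.sum_congr rfl fun g _ => by rw [hc g w w.2, smul_smul]

theorem trace_whittaker_eq_finrank [FiniteDimensional ℂ V] : LinearMap.trace ℂ V (whittaker ρ ψ) =
    Module.finrank ℂ (LinearMap.range (whittaker ρ ψ)) :=
  LinearMap.IsProj.trace ⟨LinearMap.mem_range_self _, fun _ => (mem_range_whittaker ρ ψ).1⟩

theorem trace_whittaker : LinearMap.trace ℂ V (whittaker ρ ψ) =
    (Fintype.card F : ℂ)⁻¹ * ∑ x, ψ (-x) * ρ.character (upper x) := by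
  simp [whittaker, character]

theorem apply_upper_eq_one_of_whittaker_eq_zero [CharP F 2] (hψ : ψ ≠ 1)
    (h0 : whittaker ρ ψ = 0) (y : F) : ρ (upper y) = 1 := by
  classical
  have hconj (b : F) (hb : b ≠ 0) : ∑ x, ψ (-x * b) • ρ (upper x) = 0 := by
    obtain ⟨a, ha⟩ := FiniteField.isSquare_of_char_two (ringChar.eq F 2 ▸ rfl) b⁻¹
    have ha0 : a ≠ 0 := by
      rintro rfl
      exact inv_ne_zero hb (by simpa using ha)
    let u := Units.mk0 a ha0
    have h : ∑ x, ψ (-x) • ρ (upper x) = 0 :=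
      (smul_eq_zero_iff_right (inv_ne_zero (Nat.cast_ne_zero.2 Fintype.card_ne_zero))).1 h0
    have h' := congrArg (fun f => ρ (diag u) * f * ρ (diag u)⁻¹) h
    simp only [mul_zero, zero_mul, Finset.mul_sum, Finset.sum_mul, mul_smul_comm, smul_mul_assoc,
      ← map_mul, diag_mul_upper, mul_inv_cancel_right] at h'
    rw [← h', ← Equiv.sum_comp (Equiv.mulLeft₀ b⁻¹ (inv_ne_zero hb))
      fun x => ψ (-x * b) • ρ (upper x)]
    refine Finset.sum_congr rfl fun x _ => ?_
    have hx : -(b⁻¹ * x) * b = -x := by field_simp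
    rw [Equiv.mulLeft₀_apply, hx, ha, Units.val_mk0, sq]
  have hsum : (Fintype.card F : ℂ) • (1 : Module.End ℂ V) = ∑ x, ρ (upper x) := by
    have h1 : ∑ b, ∑ x, ψ (-x * b) • ρ (upper x) = ∑ x, ρ (upper x) := by
      rw [Finset.sum_eq_single 0 (fun b _ hb => hconj b hb) (by simp)]
      simp
    rw [← h1, Finset.sum_comm]
    have h2 (x : F) : ∑ b, ψ (-x * b) • ρ (upper x) =
        if x = 0 then (Fintype.card F : ℂ) • 1 else 0 := by
      simp_rw [← Finset.sum_smul, mul_comm (-x),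
        AddChar.sum_mulShift _ (AddChar.IsPrimitive.of_ne_one hψ), neg_eq_zero]
      split_ifs with hx
      · rw [hx, upper_zero, map_one]
      · rw [Nat.cast_zero, zero_smul]
    rw [Finset.sum_congr rfl fun x _ => h2 x]
    simp
  have hcard : (Fintype.card F : ℂ) ≠ 0 := Nat.cast_ne_zero.2 Fintype.card_ne_zero
  refine smul_right_injective _ hcard ?_
  simp only
  rw [← mul_one (ρ (upper y)), ← mul_smul_comm, hsum, Finset.mul_sum,
    ← Equiv.sum_comp (Equiv.addLeft y) fun x => ρ (upper x)]
  simp only [← map_mul, ← upper_add, Equiv.coe_addLeft]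

end Representation

namespace FDRep

open Matrix.SpecialLinearGroup

variable {F : Type} [Field F] [Fintype F]

theorem span_range_apply_eq_top {G : Type} [Group G] (V : FDRep ℂ G) [Simple V] (w : V)
    (hw : w ≠ 0) : Submodule.span ℂ (Set.range fun g => V.ρ g w) = ⊤ := by
  refine eq_top_of_simple V _ (fun g x hx => ?_) ?_
  · refine Submodule.span_le.2 (?_ : _ ⊆ ((Submodule.span ℂ _).comap (V.ρ g) : Set V)) hx
    rintro _ ⟨h, rfl⟩
    refine Submodule.subset_span ⟨g * h, ?_⟩
    simp only [map_mul, Module.End.mul_apply]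
  · intro h
    refine hw ((Submodule.eq_bot_iff _).1 h w (Submodule.subset_span ⟨1, ?_⟩))
    simp only [map_one, Module.End.one_apply]

theorem trace_whittaker_of_simple [CharP F 2] (V : FDRep ℂ (SpecialLinearGroup (Fin 2) F))
    [Simple V] {ψ : AddChar F ℂ} (hψ : ψ ≠ 1) (hV : ∃ g, V.ρ g ≠ 1) :
    LinearMap.trace ℂ V (Representation.whittaker V.ρ ψ) = 1 := by
  rw [Representation.trace_whittaker_eq_finrank, Representation.finrank_range_whittaker V.ρ ψ hψ
    (span_range_apply_eq_top V), Nat.cast_one]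
  intro h0
  obtain ⟨g, hg⟩ := hV
  have h : V.ρ.ker = ⊤ :=
    eq_top_of_upper_mem (Representation.apply_upper_eq_one_of_whittaker_eq_zero V.ρ ψ hψ h0)
  exact hg (MonoidHom.mem_ker.1 (h ▸ Subgroup.mem_top g))

theorem trace_whittaker_of_forall_eq_one (V : FDRep ℂ (SpecialLinearGroup (Fin 2) F))
    {ψ : AddChar F ℂ} (hψ : ψ ≠ 1) (hV : ∀ g, V.ρ g = 1) :
    LinearMap.trace ℂ V (Representation.whittaker V.ρ ψ) = 0 := by
  have h : ∑ x, ψ (-x) = 0 := by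
    rw [← AddChar.sum_eq_zero_of_ne_one hψ]
    exact Equiv.sum_comp (Equiv.neg F) ψ
  simp only [Representation.whittaker, hV, ← Finset.sum_smul, h, zero_smul, smul_zero, map_zero]

theorem character_eq_one_of_simple {G : Type} [Group G] [Fintype G] (V : FDRep ℂ G) [Simple V]
    (hV : ∀ g, V.ρ g = 1) (g : G) : V.character g = 1 := by
  have hd (g : G) : V.character g = Module.finrank ℂ V := by
    rw [character, hV, LinearMap.trace_one]
  have h := (simple_iff_char_is_norm_one V).1 ‹_›
  simp only [hd, Finset.sum_const, Finset.card_univ, nsmul_eq_mul, ← Nat.card_eq_fintype_card] at h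
  have h1 := (mul_eq_left₀ (NeZero.ne (Nat.card G : ℂ))).1 h
  rw [hd]
  norm_cast at h1 ⊢
  exact Nat.eq_one_of_mul_eq_one_left h1

theorem exists_unique_forall_eq_one {G : Type} [Group G] [Fintype G] {N : ℕ} (χ : Fin N → FDRep ℂ G)
    (hsimple : ∀ t, Simple (χ t))
    (hdistinct : ∀ s t : Fin N, Nonempty (χ s ≅ χ t) → s = t)
    (hcomplete : ∀ W : FDRep ℂ G, Simple W → ∃ t, Nonempty (W ≅ χ t)) :
    ∃ t₀, ∀ t, (∀ g, (χ t).ρ g = 1) ↔ t = t₀ := by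
  have : Invertible (Nat.card G : ℂ) := invertibleOfNonzero (NeZero.ne _)
  let T : FDRep ℂ G := FDRep.of (Representation.trivial ℂ G ℂ)
  have hTρ (g : G) : T.ρ g = 1 := rfl
  have hT : Simple T := by
    rw [simple_iff_char_is_norm_one]
    simp only [character, hTρ, LinearMap.trace_one, Finset.sum_const, Finset.card_univ,
      nsmul_eq_mul, ← Nat.card_eq_fintype_card]
    have hd : Module.finrank ℂ T = 1 := Module.finrank_self ℂ
    rw [hd, Nat.cast_one, mul_one, mul_one]
  obtain ⟨t₀, ⟨e⟩⟩ := hcomplete T hT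
  have h₀ (g : G) : (χ t₀).ρ g = 1 := by
    rw [Iso.conj_ρ e, hTρ]
    exact LinearEquiv.conj_id _
  refine ⟨t₀, fun t => ⟨fun ht => hdistinct _ _ ?_, fun h => h ▸ h₀⟩⟩
  by_contra hne
  have h := char_orthonormal (χ t) (χ t₀)
  rw [if_neg hne] at h
  simp [character_eq_one_of_simple _ ht, character_eq_one_of_simple _ h₀] at h

theorem sum_degrees_specialLinearGroup [CharP F 2] [DecidableEq F] {N : ℕ}
    (χ : Fin N → FDRep ℂ (SpecialLinearGroup (Fin 2) F))
    (hsimple : ∀ t, Simple (χ t))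
    (hdistinct : ∀ s t : Fin N, Nonempty (χ s ≅ χ t) → s = t)
    (hcomplete : ∀ W : FDRep ℂ (SpecialLinearGroup (Fin 2) F), Simple W →
      ∃ t, Nonempty (W ≅ χ t)) :
    ∑ t, (χ t).character 1 = (Fintype.card F : ℂ) ^ 2 := by
  obtain ⟨ψ, hψ⟩ := AddChar.exists_apply_ne_zero.2 (one_ne_zero (α := F))
  replace hψ : ψ ≠ 1 := fun h => hψ (by rw [h, AddChar.one_apply])
  obtain ⟨t₀, ht₀⟩ := exists_unique_forall_eq_one χ hsimple hdistinct hcomplete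
  have hm (t : Fin N) : LinearMap.trace ℂ (χ t) (Representation.whittaker (χ t).ρ ψ) =
      1 - if t = t₀ then 1 else 0 := by
    split_ifs with h
    · rw [trace_whittaker_of_forall_eq_one _ hψ ((ht₀ t).2 h), sub_self]
    · rw [trace_whittaker_of_simple _ hψ, sub_zero]
      exact not_forall.1 fun h' => h ((ht₀ t).1 h')
  have hq := Fintype.one_lt_card (α := F)
  have hq0 : (Fintype.card F : ℂ) ≠ 0 := Nat.cast_ne_zero.2 Fintype.card_ne_zero
  have hsum : ∑ t, (χ t).character 1 *
      LinearMap.trace ℂ (χ t) (Representation.whittaker (χ t).ρ ψ) =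
        (Fintype.card F : ℂ) ^ 2 - 1 := by
    have hcol (x : F) : ∑ t, (χ t).character 1 * (χ t).character (upper x) =
        if x = 0 then (Fintype.card (SpecialLinearGroup (Fin 2) F) : ℂ) else 0 := by
      rw [sum_finrank_mul_character χ hsimple hdistinct hcomplete]
      congr 1
      refine propext ⟨fun h => ?_, fun h => h ▸ upper_zero⟩
      simpa [coe_upper] using congrArg (fun g : SpecialLinearGroup (Fin 2) F => g 0 1) h
    calc _ = ∑ t, ∑ x, (Fintype.card F : ℂ)⁻¹ * (ψ (-x) *
          ((χ t).character 1 * (χ t).character (upper x))) := by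
          refine Finset.sum_congr rfl fun t _ => ?_
          rw [Representation.trace_whittaker, Finset.mul_sum, Finset.mul_sum]
          refine Finset.sum_congr rfl fun x _ => ?_
          rw [mul_left_comm, mul_left_comm ((χ t).character 1)]
          rfl
      _ = (Fintype.card F : ℂ)⁻¹ * Fintype.card (SpecialLinearGroup (Fin 2) F) := by
          rw [Finset.sum_comm]
          simp only [← Finset.mul_sum, hcol]
          simp
      _ = _ := by
          rw [card_fin_two, Nat.cast_mul, inv_mul_cancel_left₀ hq0,
            Nat.cast_sub (Nat.one_le_pow _ _ (by omega))]
          simp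
  simp only [hm, mul_sub, mul_one, Finset.sum_sub_distrib, mul_ite, mul_zero,
    Finset.sum_ite_eq', Finset.mem_univ, if_true,
    character_eq_one_of_simple _ ((ht₀ t₀).2 rfl)] at hsum
  exact sub_left_injective hsum

end FDRep

theorem Matrix.SpecialLinearGroup.eq_one_of_mem_center_of_charTwo {F : Type*} [Field F] [CharP F 2]
    {g : SpecialLinearGroup (Fin 2) F} (hg : g ∈ Subgroup.center (SpecialLinearGroup (Fin 2) F)) :
    g = 1 := by
  obtain ⟨r, hr, hrg⟩ := mem_center_iff.1 hg
  have h : r = 1 := by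
    rw [Fintype.card_fin] at hr
    refine sub_eq_zero.1 (pow_eq_zero_iff two_ne_zero |>.1 ?_)
    rw [sub_pow_char, hr, one_pow, sub_self]
  refine Subtype.ext ?_
  rw [← hrg, h, map_one]
  rfl

theorem stmt_12 (q : ℕ) (r : ℕ) (hr : 0 < r) (hq : q = 2 ^ r)
    (F : Type) [Field F] [Fintype F] [DecidableEq F] (hF : Fintype.card F = q)
    {N : ℕ}
    (χ : Fin N → FDRep ℂ (SpecialLinearGroup (Fin 2) F))
    (hsimple : ∀ t, Simple (χ t))
    (hdistinct : ∀ s t : Fin N, Nonempty (χ s ≅ χ t) → s = t)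
    (hcomplete : ∀ W : FDRep ℂ (SpecialLinearGroup (Fin 2) F), Simple W →
      ∃ t, Nonempty (W ≅ χ t)) :
    -- the sum of the degrees of the irreducible characters is q²
    (∑ t, (χ t).character 1 = ((q : ℂ) ^ 2)) ∧
    -- consequently, for every faithful representation `V` we have `Z_V(G) = {1}` and
    -- the asymptotic coefficient is q/(q²-1)
    (∀ V : FDRep ℂ (SpecialLinearGroup (Fin 2) F),
      Function.Injective V.ρ →
      ∀ (ZV : Finset (SpecialLinearGroup (Fin 2) F))
        (ωV : SpecialLinearGroup (Fin 2) F → ℂ),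
        (∀ g, g ∈ ZV ↔ ∃ c : ℂ, V.ρ g = c • LinearMap.id) →
        (∀ g ∈ ZV, V.ρ g = ωV g • LinearMap.id) →
        ZV = {1} ∧
        ∀ n : ℕ,
          (1 / (Fintype.card (SpecialLinearGroup (Fin 2) F) : ℂ)) *
            ∑ g ∈ ZV, colSum χ g * ωV g ^ n =
          (q : ℂ) / ((q : ℂ) ^ 2 - 1)) := by
  have : CharP F 2 := charP_of_card_eq_prime_pow (hF.trans hq)
  have hdeg := FDRep.sum_degrees_specialLinearGroup χ hsimple hdistinct hcomplete
  rw [hF] at hdeg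
  refine ⟨hdeg, fun V hV ZV ωV hZ hω => ?_⟩
  have hq1 : 1 < q := hF ▸ Fintype.one_lt_card
  have hZV : ZV = {1} := by
    refine Finset.eq_singleton_iff_unique_mem.2 ⟨(hZ 1).2 ⟨1, ?_⟩, fun g hg => ?_⟩
    · rw [map_one, one_smul]
      rfl
    · obtain ⟨c, hc⟩ := (hZ g).1 hg
      refine SpecialLinearGroup.eq_one_of_mem_center_of_charTwo
        (Subgroup.mem_center_iff.2 fun h => hV ?_)
      rw [map_mul, map_mul, hc]
      ext v
      simp
  refine ⟨hZV, fun n => ?_⟩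
  have hω1 : ωV 1 = 1 := by
    have h := hω 1 (by simp [hZV])
    have hV1 : Nontrivial V := by
      by_contra hsub
      rw [not_nontrivial_iff_subsingleton] at hsub
      have h01 : (SpecialLinearGroup.upper 1 : SpecialLinearGroup (Fin 2) F) =
          SpecialLinearGroup.upper 0 := hV (Subsingleton.elim _ _)
      simpa [SpecialLinearGroup.coe_upper] using
        congrArg (fun g : SpecialLinearGroup (Fin 2) F => g 0 1) h01
    obtain ⟨v, hv⟩ := exists_ne (0 : V)
    have hv' := LinearMap.congr_fun h v
    rw [map_one] at hv'
    exact smul_left_injective ℂ hv (by simpa using hv'.symm)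
  have hq0 : (q : ℂ) ≠ 0 := by
    norm_cast
    omega
  rw [hZV, Finset.sum_singleton, hω1, one_pow, mul_one, colSum, hdeg,
    SpecialLinearGroup.card_fin_two, hF, Nat.cast_mul, Nat.cast_sub (Nat.one_le_pow _ _ (by omega)),
    Nat.cast_pow, Nat.cast_one, one_div, sq, ← div_eq_inv_mul, mul_div_mul_left _ _ hq0]
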